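/- Let Y be the k×k diagonal matrix over the polynomial ring ℤ[Y_1,…,Y_k] with diagonal entries Y_1,…,Y_k, and let τ = (t_1,…,t_u) be a Young diagram with t_1 ≤ k. Then every monomial contained in the ideal I^τ(Y) = Π_{i=1}^u I_{t_i}(Y) has shape ≥ τ in the partial order on Young diagrams. -/

import Mathlib

noncomputable section

/-- `I_t(A)`: the ideal of `R` generated by the `t × t` minors of the matrix `A`. -/
def minorsIdeal {R : Type*} [CommRing R] (t : ℕ) {N M : Type*} (A : Matrix N M R) : Ideal R :=
  Ideal.span {x : R | ∃ (r : Fin t → N) (c : Fin t → M), x = (A.submatrix r c).det}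

/-- A Young diagram `σ = (s_1, …, s_u)`, recorded as the multiset of its (positive) parts. -/
def IsYoungDiagram (σ : Multiset ℕ) : Prop := ∀ s ∈ σ, 0 < s

/-- `γ_j(σ) = Σ_i max (0, s_i - j + 1)` (written with truncated subtraction). -/
def youngGamma (σ : Multiset ℕ) (j : ℕ) : ℕ := (σ.map fun s => s + 1 - j).sum

/-- The partial order on Young diagrams: `σ ≤ τ` iff `γ_j σ ≤ γ_j τ` for all `j ≥ 1`. -/
def YoungLE (σ τ : Multiset ℕ) : Prop := ∀ j, 1 ≤ j → youngGamma σ j ≤ youngGamma τ j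

/-- `I^σ(A) = Π_i I_{s_i}(A)`. -/
def prodMinorsIdeal {R : Type*} [CommRing R] {N M : Type*} (A : Matrix N M R)
    (σ : Multiset ℕ) : Ideal R := (σ.map fun s => minorsIdeal s A).prod

/-- The shape of the monomial with exponent vector `e`: writing the monomial `f` as
`f = f_1 ⋯ f_u` with each `f_i` squarefree and `f_{i+1} ∣ f_i`, the shape is
`(deg f_1, …, deg f_u)`, where `deg f_i = #{j | e j ≥ i}`. -/
def monomialShape {k : ℕ} (e : Fin k →₀ ℕ) : Multiset ℕ :=
  Multiset.filter (fun c => 0 < c)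
    ((Multiset.range (e.sum fun _ v => v)).map fun i =>
      (Finset.univ.filter fun j => i + 1 ≤ e j).card)

/-- A finite type contains, for each `m` at most its cardinality, a set of `m` elements on which
`f` takes its largest values. -/
theorem exists_card_eq_forall_notMem_le {α : Type*} [Fintype α] (f : α → ℕ) (m : ℕ)
    (hm : m ≤ Fintype.card α) :
    ∃ S : Finset α, S.card = m ∧ ∀ v ∈ S, ∀ w ∉ S, f w ≤ f v := by
  classical
  induction m with
  | zero => exact ⟨∅, by simp⟩
  | succ m ih =>
    obtain ⟨S, hS, hle⟩ := ih (by omega)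
    have hne : Sᶜ.Nonempty := by
      rw [← Finset.card_pos, Finset.card_compl]
      omega
    obtain ⟨x, hx, hmax⟩ := Finset.exists_max_image Sᶜ f hne
    rw [Finset.mem_compl] at hx
    refine ⟨insert x S, by rw [Finset.card_insert_of_notMem hx, hS], fun v hv w hw => ?_⟩
    simp only [Finset.mem_insert, not_or] at hv hw
    obtain rfl | hv := hv
    · exact hmax w (Finset.mem_compl.2 hw.2)
    · exact hle v hv w hw.2

theorem youngGamma_filter_pos (σ : Multiset ℕ) {j : ℕ} (hj : 1 ≤ j) :
    youngGamma (σ.filter fun c => 0 < c) j = youngGamma σ j := by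
  induction σ using Multiset.induction_on with
  | empty => simp
  | cons a σ ih =>
    unfold youngGamma at *
    by_cases ha : 0 < a
    · simp [ha, ih]
    · simp [ha, ih]
      omega

theorem youngGamma_monomialShape {k : ℕ} (e : Fin k →₀ ℕ) {j : ℕ} (hj : 1 ≤ j) :
    youngGamma (monomialShape e) j =
      ∑ i ∈ Finset.range (e.sum fun _ v => v),
        ((Finset.univ.filter fun v => i + 1 ≤ e v).card + 1 - j) := by
  rw [monomialShape, youngGamma_filter_pos _ hj, youngGamma, Multiset.map_map]
  rfl

/-- Outside a suitable set of at most `j - 1` variables, a monomial has degree at most `γ_j` of its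
shape. -/
theorem exists_sum_compl_le_youngGamma {k : ℕ} (e : Fin k →₀ ℕ) {j : ℕ} (hj : 1 ≤ j) :
    ∃ S : Finset (Fin k), S.card < j ∧ ∑ v ∈ Sᶜ, e v ≤ youngGamma (monomialShape e) j := by
  obtain hjk | hjk := lt_or_ge k j
  · exact ⟨Finset.univ, by simpa using hjk, by simp⟩
  obtain ⟨S, hS, hle⟩ := exists_card_eq_forall_notMem_le (fun v => e v) (j - 1)
    (by rw [Fintype.card_fin]; omega)
  refine ⟨S, by omega, ?_⟩
  set N := e.sum fun _ v => v with hN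
  have hbound (v : Fin k) : e v ≤ N := by
    rw [hN, Finsupp.sum_fintype _ _ (by simp)]
    exact Finset.single_le_sum (f := fun v => e v) (fun _ _ => Nat.zero_le _) (Finset.mem_univ v)
  have hlevel (v : Fin k) : e v = ∑ i ∈ Finset.range N, if i + 1 ≤ e v then 1 else 0 := by
    have : (Finset.range N).filter (fun i => i + 1 ≤ e v) = Finset.range (e v) := by
      ext i
      have := hbound v
      simp only [Finset.mem_filter, Finset.mem_range]
      omega
    rw [← Finset.card_filter, this, Finset.card_range]
  rw [youngGamma_monomialShape e hj, Finset.sum_congr rfl fun v _ => hlevel v, Finset.sum_comm]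
  refine Finset.sum_le_sum fun i _ => ?_
  rw [← Finset.card_filter]
  by_cases hsub : S ⊆ Finset.univ.filter fun v => i + 1 ≤ e v
  · have hdiff : (Sᶜ.filter fun v => i + 1 ≤ e v) =
        (Finset.univ.filter fun v => i + 1 ≤ e v) \ S := by
      ext v
      simp [and_comm]
    rw [hdiff, Finset.card_sdiff_of_subset hsub]
    omega
  · obtain ⟨v, hv, hvi⟩ := Finset.not_subset.1 hsub
    rw [Finset.filter_false_of_mem]
    · simp
    · intro w hw hwi
      exact hvi (by simpa using hwi.trans (hle v hv w (Finset.mem_compl.1 hw)))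

/-- If all but fewer than `j` entries of a diagonal matrix are divisible by `x`, then its `t × t`
minors are divisible by `x ^ (t + 1 - j)`. -/
theorem pow_dvd_det_submatrix_diagonal {R N : Type*} [CommRing R] [DecidableEq N]
    {d : N → R} {x : R} {S : Finset N} {j : ℕ} (hS : S.card < j) (hd : ∀ v ∉ S, x ∣ d v)
    {t : ℕ} (r c : Fin t → N) :
    x ^ (t + 1 - j) ∣ ((Matrix.diagonal d).submatrix r c).det := by
  by_cases hr : Function.Injective r
  · have hfactor : (Matrix.diagonal d).submatrix r c =
        Matrix.of fun a b => d (r a) * (1 : Matrix N N R).submatrix r c a b := by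
      ext a b
      simp [Matrix.diagonal_apply, Matrix.one_apply]
    rw [hfactor, Matrix.det_mul_column]
    refine Dvd.dvd.mul_right ?_ _
    have hin : (Finset.univ.filter fun a => r a ∈ S).card ≤ S.card :=
      Finset.card_le_card_of_injOn r (fun a ha => by simpa using ha) hr.injOn
    have hcard := Finset.card_filter_add_card_filter_not (s := (Finset.univ : Finset (Fin t)))
      (fun a => r a ∈ S)
    rw [Finset.card_univ, Fintype.card_fin] at hcard
    calc x ^ (t + 1 - j) ∣ x ^ (Finset.univ.filter fun a => r a ∉ S).card :=
          pow_dvd_pow _ (by omega)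
      _ = ∏ a ∈ Finset.univ.filter fun a => r a ∉ S, x := by rw [Finset.prod_const]
      _ ∣ ∏ a ∈ Finset.univ.filter fun a => r a ∉ S, d (r a) :=
          Finset.prod_dvd_prod_of_dvd _ _ fun a ha => hd _ (by simpa using ha)
      _ ∣ ∏ a, d (r a) := Finset.prod_dvd_prod_of_subset _ _ _ (Finset.filter_subset _ _)
  · obtain ⟨a, b, hab, hne⟩ := Function.not_injective_iff.1 hr
    rw [Matrix.det_zero_of_row_eq hne (by ext; simp [hab])]
    exact dvd_zero _

theorem map_prodMinorsIdeal_diagonal_le {R R' N : Type*} [CommRing R] [CommRing R']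
    [DecidableEq N] (φ : R →+* R') {d : N → R} {x : R'} {S : Finset N} {j : ℕ}
    (hS : S.card < j) (hd : ∀ v ∉ S, x ∣ φ (d v)) (τ : Multiset ℕ) :
    (prodMinorsIdeal (Matrix.diagonal d) τ).map φ ≤ Ideal.span {x ^ youngGamma τ j} := by
  induction τ using Multiset.induction_on with
  | empty => simp [youngGamma]
  | cons t τ ih =>
    unfold prodMinorsIdeal youngGamma at *
    rw [Multiset.map_cons, Multiset.prod_cons, Multiset.map_cons, Multiset.sum_cons, pow_add,
      ← Ideal.span_singleton_mul_span_singleton, Ideal.map_mul]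
    refine Ideal.mul_mono ?_ ih
    rw [minorsIdeal, Ideal.map_span, Ideal.span_le]
    rintro _ ⟨_, ⟨r, c, rfl⟩, rfl⟩
    rw [SetLike.mem_coe, Ideal.mem_span_singleton, RingHom.map_det, RingHom.mapMatrix_apply,
      ← Matrix.submatrix_map, Matrix.diagonal_map (map_zero φ)]
    exact pow_dvd_det_submatrix_diagonal hS hd r c

/-- Let `Y` be the `k × k` diagonal matrix with diagonal entries the indeterminates
`Y_1, …, Y_k` of `ℤ[Y_1, …, Y_k]`, and let `τ` be a Young diagram all of whose parts are
at most `k`. Then every monomial contained in the ideal `I^τ(Y) = Π_i I_{t_i}(Y)` has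
shape `≥ τ`. -/
theorem youngLE_monomialShape_of_mem_prodMinors {k : ℕ} (τ : Multiset ℕ)
    (hτ : IsYoungDiagram τ) (hτk : ∀ t ∈ τ, t ≤ k) (e : Fin k →₀ ℕ)
    (he : MvPolynomial.monomial e (1 : ℤ) ∈
      prodMinorsIdeal (Matrix.diagonal fun i : Fin k => (MvPolynomial.X i : MvPolynomial (Fin k) ℤ)) τ) :
    YoungLE τ (monomialShape e) := by
  intro j hj
  obtain ⟨S, hS, hle⟩ := exists_sum_compl_le_youngGamma e hj
  refine le_trans ?_ hle
  let φ : MvPolynomial (Fin k) ℤ →+* Polynomial ℤ :=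
    MvPolynomial.eval₂Hom Polynomial.C fun v => if v ∈ S then 1 else Polynomial.X
  have hmem := map_prodMinorsIdeal_diagonal_le φ (x := Polynomial.X) hS
    (fun v hv => by simp [φ, hv]) τ (Ideal.mem_map_of_mem φ he)
  have hφ : φ (MvPolynomial.monomial e 1) = Polynomial.X ^ ∑ v ∈ Sᶜ, e v := by
    simp only [φ, MvPolynomial.coe_eval₂Hom, MvPolynomial.eval₂_monomial, map_one, one_mul]
    rw [Finsupp.prod_fintype _ _ (by simp), ← Finset.prod_mul_prod_compl S,
      Finset.prod_eq_one fun v hv => by simp [hv], one_mul, ← Finset.prod_pow_eq_pow_sum]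
    exact Finset.prod_congr rfl fun v hv => by rw [if_neg (Finset.mem_compl.1 hv)]
  rw [hφ, Ideal.mem_span_singleton] at hmem
  exact (pow_dvd_pow_iff Polynomial.X_ne_zero Polynomial.not_isUnit_X).1 hmem
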